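/- Let m be an integer with m ≥ 0 or m odd (possibly negative), and let f be holomorphic on an open neighbourhood of 0 in ℂ with f(0) ≠ 0. Then there exist an open set V ⊆ ℂ containing 0 and an injective holomorphic map w : V → ℂ with w(0) = 0 and w'(0) ≠ 0 such that f(z)·z^m = w(z)^m·w'(z)² for every z ∈ V with z ≠ 0. -/

import Mathlib

open Filter Topology

/-- A nonvanishing analytic function has an analytic logarithm near the given point. -/
lemma AnalyticAt.exists_exp_eventuallyEq {f : ℂ → ℂ} {z₀ : ℂ} (hf : AnalyticAt ℂ f z₀)
    (h0 : f z₀ ≠ 0) :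
    ∃ L : ℂ → ℂ, AnalyticAt ℂ L z₀ ∧ ∀ᶠ z in 𝓝 z₀, Complex.exp (L z) = f z := by
  refine ⟨fun z ↦ Complex.log (f z / f z₀) + Complex.log (f z₀), ?_, ?_⟩
  · have hdiv : AnalyticAt ℂ (fun z ↦ f z / f z₀) z₀ := hf.div analyticAt_const h0
    exact (hdiv.clog (by simp [h0])).add analyticAt_const
  · filter_upwards [hf.continuousAt.eventually_ne h0] with z hz
    rw [Complex.exp_add, Complex.exp_log (div_ne_zero hz h0), Complex.exp_log h0,
      div_mul_cancel₀ _ h0]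

/-- The equation `z · deriv h + a h = g` has an analytic solution near `0` when `-a` is not a natural
number. -/
lemma AnalyticAt.exists_mul_deriv_add_mul_eq {g : ℂ → ℂ} (hg : AnalyticAt ℂ g 0) {a : ℂ}
    (ha : ∀ n : ℕ, (n : ℂ) + a ≠ 0) :
    ∃ h : ℂ → ℂ, AnalyticAt ℂ h 0 ∧ ∀ᶠ z in 𝓝 0, z * deriv h z + a * h z = g z := by
  obtain ⟨p, hp⟩ := hg
  obtain ⟨ρ, hρ0, hρ⟩ := ENNReal.lt_iff_exists_nnreal_btwn.1 hp.radius_pos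
  replace hρ0 : (0 : ℝ) < ρ := by exact_mod_cast hρ0
  have hsum : Summable fun n ↦ ‖p.coeff n‖ * (ρ : ℝ) ^ n := by
    simpa only [FormalMultilinearSeries.norm_apply_eq_norm_coef] using p.summable_norm_mul_pow hρ
  obtain ⟨K, hK⟩ : ∃ K : ℝ, ∀ n : ℕ, ‖(n : ℂ) / (n + a)‖ ≤ K := by
    obtain ⟨K, hK⟩ := (Metric.isBounded_range_of_tendsto _
      (tendsto_natCast_div_add_atTop a)).exists_norm_le
    exact ⟨K, fun n ↦ hK _ ⟨n, rfl⟩⟩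
  set b : ℕ → ℂ := fun n ↦ p.coeff n / (n + a) with hb
  have hbound (n : ℕ) (z : ℂ) (hz : z ∈ Metric.ball (0 : ℂ) ρ) :
      ‖b n * (n * z ^ (n - 1))‖ ≤ K / ρ * (‖p.coeff n‖ * (ρ : ℝ) ^ n) := by
    have hz' : ‖z‖ ≤ ρ := by simpa using (Metric.mem_ball.1 hz).le
    have hK0 : 0 ≤ K := (norm_nonneg _).trans (hK 0)
    rcases n with _ | n
    · simp only [Nat.cast_zero, zero_mul, mul_zero, norm_zero]
      positivity
    · calc ‖b (n + 1) * ((n + 1 : ℕ) * z ^ n)‖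
          = ‖((n + 1 : ℕ) : ℂ) / ((n + 1 : ℕ) + a)‖ * (‖p.coeff (n + 1)‖ * ‖z‖ ^ n) := by
            rw [← norm_pow, ← norm_mul, ← norm_mul]
            congr 1
            simp only [hb]
            ring
        _ ≤ K * (‖p.coeff (n + 1)‖ * (ρ : ℝ) ^ n) := by
            gcongr
            exact hK _
        _ = K / ρ * (‖p.coeff (n + 1)‖ * (ρ : ℝ) ^ (n + 1)) := by
            field_simp
            ring
  have hderiv (z : ℂ) (hz : z ∈ Metric.ball (0 : ℂ) ρ) :
      HasDerivAt (fun z ↦ ∑' n, b n * z ^ n) (∑' n, b n * (n * z ^ (n - 1))) z :=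
    hasDerivAt_tsum_of_isPreconnected (hsum.mul_left (K / ρ)) Metric.isOpen_ball
      (convex_ball _ _).isPreconnected (fun n y _ ↦ (hasDerivAt_pow n y).const_mul (b n))
      hbound (Metric.mem_ball_self hρ0)
      (summable_of_ne_finset_zero (s := {0}) fun n hn ↦ by
        simp_all) hz
  have hball : Metric.ball (0 : ℂ) ρ ∈ 𝓝 0 := Metric.ball_mem_nhds _ hρ0
  refine ⟨fun z ↦ ∑' n, b n * z ^ n, ?_, ?_⟩
  · exact DifferentiableOn.analyticAt
      (fun z hz ↦ (hderiv z hz).differentiableAt.differentiableWithinAt) hball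
  · filter_upwards [hball, hasFPowerSeriesAt_iff.1 hp] with z hz hgz
    rw [(hderiv z hz).deriv, ← tsum_mul_left, ← tsum_mul_left]
    have hs : Summable fun n ↦ z * (b n * (n * z ^ (n - 1))) :=
      (Summable.of_norm_bounded (hsum.mul_left (K / ρ)) fun n ↦ hbound n z hz).mul_left z
    have hcoeff (n : ℕ) :
        z * (b n * (n * z ^ (n - 1))) + a * (b n * z ^ n) = z ^ n • p.coeff n := by
      have hn : z * (n * z ^ (n - 1)) = n * z ^ n := by
        rcases n with _ | n
        · simp
        · simp only [Nat.add_sub_cancel]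
          ring
      have hbn : ((n : ℂ) + a) * b n = p.coeff n := mul_div_cancel₀ _ (ha n)
      rw [smul_eq_mul, ← hbn]
      linear_combination b n * hn
    have hs' : Summable fun n ↦ a * (b n * z ^ n) := by
      refine (hgz.summable.sub hs).congr fun n ↦ ?_
      rw [← hcoeff n]
      ring
    rw [← hs.tsum_add hs', tsum_congr hcoeff, hgz.tsum_eq, zero_add]

/-- Local normal form of a quadratic differential `f(z)·z^m·dz²` at a zero of any order
(`m ≥ 0`) or at a pole of odd order (`m` odd, possibly negative): there is a local
coordinate change `w`, fixing `0` with `w'(0) ≠ 0`, such that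
`f(z)·z^m = w(z)^m·w'(z)²` near `0`. -/
theorem quadratic_differential_normal_form_zero_or_odd_pole
    (m : ℤ) (hm : 0 ≤ m ∨ Odd m)
    (U : Set ℂ) (hU : IsOpen U) (h0U : (0 : ℂ) ∈ U)
    (f : ℂ → ℂ) (hf : DifferentiableOn ℂ f U) (hf0 : f 0 ≠ 0) :
    ∃ V : Set ℂ, IsOpen V ∧ (0 : ℂ) ∈ V ∧ V ⊆ U ∧
      ∃ w : ℂ → ℂ, Set.InjOn w V ∧ DifferentiableOn ℂ w V ∧
        w 0 = 0 ∧ deriv w 0 ≠ 0 ∧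
        ∀ z ∈ V, z ≠ 0 → f z * z ^ m = w z ^ m * (deriv w z) ^ 2 := by
  have hm2 (n : ℕ) : (n : ℂ) + ((m : ℂ) / 2 + 1) ≠ 0 := by
    intro h
    have h' : 2 * (n : ℤ) + m + 2 = 0 := by
      have : (2 * (n : ℂ) + m + 2) = 0 := by linear_combination 2 * h
      exact_mod_cast this
    rcases hm with hm | ⟨k, rfl⟩ <;> omega
  set a : ℂ := (m : ℂ) / 2 + 1 with ha
  have ha0 : a ≠ 0 := by simpa using hm2 0
  obtain ⟨F, hF, hFf⟩ := (hf.analyticAt (hU.mem_nhds h0U)).exists_exp_eventuallyEq hf0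
  have hg : AnalyticAt ℂ (fun z ↦ Complex.exp (F z / 2)) 0 := hF.div_const.cexp
  obtain ⟨h, hh, hode⟩ := hg.exists_mul_deriv_add_mul_eq hm2
  have hah0 : a * h 0 ≠ 0 := by
    have := hode.self_of_nhds
    rw [zero_mul, zero_add] at this
    exact this ▸ Complex.exp_ne_zero _
  have hah : AnalyticAt ℂ (fun z ↦ a * h z) 0 := analyticAt_const.mul hh
  obtain ⟨L, hL, hLh⟩ := hah.exists_exp_eventuallyEq hah0
  set w : ℂ → ℂ := fun z ↦ z * Complex.exp (L z / a) with hw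
  have hwan : AnalyticAt ℂ w 0 := analyticAt_id.mul hL.div_const.cexp
  have hderiv {z : ℂ} (hz : AnalyticAt ℂ L z) :
      deriv w z = Complex.exp (L z / a) * (1 + z * (deriv L z / a)) := by
    have := (hasDerivAt_id z).mul ((hz.differentiableAt.hasDerivAt.div_const a).cexp)
    refine (this.congr_deriv ?_).deriv
    simp only [id]
    ring
  have hdw : deriv w 0 ≠ 0 := by
    rw [hderiv hL]
    simp
  have hinj := hwan.hasStrictDerivAt.eventually_left_inverse hdw
  obtain ⟨V, hV, hVo, h0V⟩ := eventually_nhds_iff.1 <|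
    (hU.eventually_mem h0U).and <| hinj.and <|
    hwan.eventually_analyticAt.and <| hL.eventually_analyticAt.and <|
    hh.eventually_analyticAt.and <| hFf.and <| hode.and hLh.eventually_nhds
  refine ⟨V, hVo, h0V, fun z hz ↦ (hV z hz).1, w, ?_, ?_, by simp [hw], hdw, ?_⟩
  · intro x hx y hy hxy
    rw [← (hV x hx).2.1, ← (hV y hy).2.1, hxy]
  · exact fun z hz ↦ (hV z hz).2.2.1.differentiableAt.differentiableWithinAt
  intro z hz _
  obtain ⟨-, -, -, hLz, hhz, hFz, hodez, hLhz⟩ := hV z hz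
  have hL' : Complex.exp (L z) * deriv L z = a * deriv h z :=
    (hLz.differentiableAt.hasDerivAt.cexp.congr_of_eventuallyEq
      (hLhz.mono fun _ hx ↦ hx.symm)).unique (hhz.differentiableAt.hasDerivAt.const_mul a)
  have hexp : Complex.exp (L z / a) ^ m * Complex.exp (L z / a) ^ 2 = Complex.exp (L z) ^ 2 := by
    rw [← Complex.exp_int_mul, ← Complex.exp_nat_mul, ← Complex.exp_nat_mul, ← Complex.exp_add]
    congr 1
    have : (m : ℂ) = 2 * a - 2 := by rw [ha]; ring
    rw [this]
    push_cast
    field_simp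
    ring
  have hsq : Complex.exp (L z) * (1 + z * (deriv L z / a)) = Complex.exp (F z / 2) := by
    rw [← hodez, ← hLhz.self_of_nhds]
    field_simp
    linear_combination z * hL'
  calc f z * z ^ m = z ^ m * Complex.exp (F z / 2) ^ 2 := by
        rw [← hFz, ← Complex.exp_nat_mul]
        push_cast
        rw [mul_div_cancel₀ _ two_ne_zero, mul_comm]
    _ = z ^ m * (Complex.exp (L z) ^ 2 * (1 + z * (deriv L z / a)) ^ 2) := by
        rw [← hsq, mul_pow]
    _ = w z ^ m * deriv w z ^ 2 := by
        rw [← hexp, hderiv hLz, hw, mul_zpow]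
        ring
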